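/- arXiv:2509.16646 — 3 statements merged into one kernel-verified Lean document; each statement's English description precedes it below -/
import Mathlib

section
/- Let Σ_n = (K_n, σ) be a doubly signed complete graph whose triangles realize exactly three distinct double signs x, y, z ∈ F. Then for every vertex v of Σ_n, each of the three values x, y, z is the double sign of some triangle containing v. -/
/-- The Klein four-group, written additively. -/
abbrev F : Type := ZMod 2 × ZMod 2

/-- The double sign of the triangle spanned by three vertices. -/
def triSign {n : ℕ} (σ : Sym2 (Fin n) → F) (a b c : Fin n) : F :=
  σ s(a, b) + σ s(b, c) + σ s(a, c)

/-- The double sign of a walk: the sum of the labels of its edges. -/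
def walkSign {n : ℕ} (σ : Sym2 (Fin n) → F) {u v : Fin n}
    (w : (⊤ : SimpleGraph (Fin n)).Walk u v) : F :=
  (w.edges.map σ).sum

theorem F.add_self (g : F) : g + g = 0 :=
  Prod.ext (CharTwo.add_self_eq_zero g.1) (CharTwo.add_self_eq_zero g.2)

theorem triSign_swap {n : ℕ} (σ : Sym2 (Fin n) → F) (a b c : Fin n) :
    triSign σ b a c = triSign σ a b c := by
  simp only [triSign, Sym2.eq_swap (a := b) (b := a)]
  abel

theorem triSign_rotate {n : ℕ} (σ : Sym2 (Fin n) → F) (a b c : Fin n) :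
    triSign σ c a b = triSign σ a b c := by
  simp only [triSign, Sym2.eq_swap (a := c)]
  abel

/-- The signs of the four triangles on four vertices sum to zero. -/
theorem triSign_eq_add {n : ℕ} (σ : Sym2 (Fin n) → F) (v a b c : Fin n) :
    triSign σ a b c = triSign σ v a b + triSign σ v b c + triSign σ v a c := by
  have e : triSign σ v a b + triSign σ v b c + triSign σ v a c =
      triSign σ a b c + (σ s(v, a) + σ s(v, a)) + (σ s(v, b) + σ s(v, b)) +
        (σ s(v, c) + σ s(v, c)) := by
    simp only [triSign]
    abel
  rw [e]
  simp only [F.add_self, add_zero]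

/-- A sum of three elements, two of which coincide, is one of the summands. -/
theorem F.add_mem_of_eq {p q r : F} (h : p = q ∨ p = r ∨ q = r) :
    p + q + r = p ∨ p + q + r = q ∨ p + q + r = r := by
  rcases h with rfl | rfl | rfl
  · simp [F.add_self]
  · right; left
    rw [add_right_comm, F.add_self, zero_add]
  · left
    rw [add_assoc, F.add_self, add_zero]

theorem stmt4 (n : ℕ) (σ : Sym2 (Fin n) → F) (x y z : F)
    (hxy : x ≠ y) (hxz : x ≠ z) (hyz : y ≠ z)
    (h : {g : F | ∃ a b c : Fin n,
        a ≠ b ∧ a ≠ c ∧ b ≠ c ∧ triSign σ a b c = g} = {x, y, z}) :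
    ∀ v : Fin n, ∀ w ∈ ({x, y, z} : Set F),
      ∃ a b : Fin n, a ≠ b ∧ a ≠ v ∧ b ≠ v ∧ triSign σ v a b = w := by
  intro v w hw
  by_contra! hmiss
  obtain ⟨a, b, c, hab, hac, hbc, habc⟩ := h.symm ▸ hw
  have hva : a ≠ v := by
    rintro rfl
    exact hmiss b c hbc hab.symm hac.symm habc
  have hvb : b ≠ v := by
    rintro rfl
    exact hmiss a c hac hab hbc.symm ((triSign_swap σ a b c).trans habc)
  have hvc : c ≠ v := by
    rintro rfl
    exact hmiss a b hab hac hbc ((triSign_rotate σ a b c).trans habc)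
  have hmem : ∀ i j, i ≠ j → i ≠ v → j ≠ v →
      triSign σ v i j = x ∨ triSign σ v i j = y ∨ triSign σ v i j = z := by
    intro i j hij hi hj
    have : triSign σ v i j ∈ ({x, y, z} : Set F) :=
      h ▸ ⟨v, i, j, hi.symm, hj.symm, hij, rfl⟩
    simpa using this
  have m₁ := hmem a b hab hva hvb
  have m₂ := hmem b c hbc hvb hvc
  have m₃ := hmem a c hac hva hvc
  have n₁ := hmiss a b hab hva hvb
  have n₂ := hmiss b c hbc hvb hvc
  have n₃ := hmiss a c hac hva hvc
  rw [triSign_eq_add σ v] at habc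
  simp only [Set.mem_insert_iff, Set.mem_singleton_iff] at hw
  have hcoincide : triSign σ v a b = triSign σ v b c ∨ triSign σ v a b = triSign σ v a c ∨
      triSign σ v b c = triSign σ v a c := by
    clear habc h hmem hmiss
    generalize triSign σ v a b = p, triSign σ v b c = q, triSign σ v a c = r at *
    grind
  rcases F.add_mem_of_eq hcoincide with e | e | e
  · exact n₁ (e.symm.trans habc)
  · exact n₂ (e.symm.trans habc)
  · exact n₃ (e.symm.trans habc)
end

section
/- Let n ≥ 6 and let Σ_n = (K_n, σ) be a doubly signed complete graph whose triangles realize exactly three distinct double signs. Then for every g ∈ F there exists a Hamiltonian circle of Σ_n with double sign g. -/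
/-- The sum of the labels `c a b` over the consecutive pairs `a, b` of a list. -/
def pathSum {V A : Type*} [AddMonoid A] (c : V → V → A) : List V → A
  | a :: b :: l => c a b + pathSum c (b :: l)
  | _ => 0

theorem pathSum_append {V A : Type*} [AddMonoid A] (c : V → V → A) (l r : List V) (a : V) :
    pathSum c (l ++ a :: r) = pathSum c (l ++ [a]) + pathSum c (a :: r) := by
  induction l with
  | nil => simp [pathSum]
  | cons b l ih =>
    cases l with
    | nil => simp [pathSum]
    | cons b' l => simp_all [pathSum, add_assoc]

/-- Switching at `v`: closing a path up through `v` gives the sum of the signs of the triangles that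
`v` spans with the edges of the path. -/
theorem pathSum_append_singleton_eq_triSign {n : ℕ} (σ : Sym2 (Fin n) → F) (v a : Fin n)
    (l : List (Fin n)) :
    pathSum (fun a b => σ s(a, b)) (a :: l ++ [v]) = pathSum (triSign σ v) (a :: l) + σ s(v, a) := by
  induction l generalizing a with
  | nil => simp [pathSum, Sym2.eq_swap]
  | cons b l ih =>
    have hb := ih b
    simp only [List.cons_append, pathSum, triSign] at hb ⊢
    rw [hb]
    generalize pathSum (triSign σ v) (b :: l) = t
    generalize σ s(v, a) = p, σ s(a, b) = q, σ s(v, b) = r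
    rw [show p + q + r + t + p = q + (t + r) + (p + p) by abel, F.add_self, add_zero]

/-- A repetition-free list of vertices is the support of a walk in the complete graph. -/
theorem exists_walk_of_nodup {n : ℕ} (σ : Sym2 (Fin n) → F) (a b : Fin n) (l : List (Fin n))
    (h : (a :: l ++ [b]).Nodup) :
    ∃ w : (⊤ : SimpleGraph (Fin n)).Walk a b, w.support = a :: l ++ [b] ∧
      walkSign σ w = pathSum (fun a b => σ s(a, b)) (a :: l ++ [b]) := by
  induction l generalizing a with
  | nil =>
    have hab : a ≠ b := by simpa using h
    exact ⟨.cons hab .nil, by simp, by simp [walkSign, pathSum]⟩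
  | cons c l ih =>
    obtain ⟨w, hw, hs⟩ := ih c h.of_cons
    have hac : a ≠ c := by
      rintro rfl
      simp at h
    refine ⟨.cons hac w, by simp [hw], ?_⟩
    simp only [walkSign] at hs
    simp [walkSign, pathSum, hs]

/-- Closing up an enumeration of the vertices gives a Hamiltonian cycle, whose sign is computed by
switching at the first vertex. -/
theorem exists_isHamiltonianCycle_of_nodup {n : ℕ} (σ : Sym2 (Fin n) → F) (v : Fin n)
    (l : List (Fin n)) (h : (v :: l).Nodup) (hl : 2 ≤ l.length) (hmem : ∀ x, x ∈ v :: l) :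
    ∃ w : (⊤ : SimpleGraph (Fin n)).Walk v v,
      w.IsHamiltonianCycle ∧ walkSign σ w = pathSum (triSign σ v) l := by
  match l, hl with
  | a :: b :: l, _ =>
    have h' : (a :: b :: l ++ [v]).Nodup := by
      have : (a :: b :: l ++ [v]).Perm (v :: a :: b :: l) := List.perm_append_singleton _ _
      exact this.nodup_iff.2 h
    obtain ⟨w, hw, hs⟩ := exists_walk_of_nodup σ b v l h'.of_cons
    have hva : v ≠ a := by rintro rfl; simp at h
    have hvb : v ≠ b := by rintro rfl; simp at h
    have hab : a ≠ b := by rintro rfl; simp at h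
    have hpath : (SimpleGraph.Walk.cons (G := ⊤) hab w).support = a :: b :: l ++ [v] := by simp [hw]
    refine ⟨.cons hva (.cons hab w), ?_, ?_⟩
    · rw [SimpleGraph.Walk.isHamiltonianCycle_isCycle_and_isHamiltonian_tail]
      have hp : (SimpleGraph.Walk.cons (G := ⊤) hab w).IsPath := by
        rw [SimpleGraph.Walk.isPath_def, hpath]
        exact h'
      refine ⟨?_, ?_⟩
      · rw [SimpleGraph.Walk.cons_isCycle_iff]
        refine ⟨hp, ?_⟩
        rw [SimpleGraph.Walk.edges_cons, List.mem_cons, Sym2.eq_swap]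
        rintro (he | he)
        · simp [hva, hvb] at he
        · have := w.fst_mem_support_of_mem_edges he
          rw [hw] at this
          exact (List.nodup_cons.1 h').1 this
      · refine SimpleGraph.Walk.IsPath.isHamiltonian_of_mem (by simpa using hp) fun x => ?_
        have := hmem x
        simp [hw] at this ⊢
        tauto
    · have ha := pathSum_append_singleton_eq_triSign σ v a (b :: l)
      simp only [walkSign] at hs
      simp only [List.cons_append, pathSum] at ha hs
      simp only [walkSign, SimpleGraph.Walk.edges_cons, List.map_cons, List.sum_cons, hs, ha]
      rw [add_left_comm, F.add_self, add_zero]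
      rfl

set_option synthInstance.maxSize 10000 in
theorem F.eq_of_independent (p δ τ s : F) (hδ : δ ≠ 0) (hτ : τ ≠ 0) (hτδ : τ ≠ δ) :
    s = p ∨ s = p + δ ∨ s = p + τ ∨ s = p + τ + δ := by
  decide +revert

/-- If `δ = c a d + c b d` and the sum `τ` of `c` over the triangles `abc` and `cde` are independent,
then the orderings of `a, b, c, d` continued by `e` realize every sum. -/
theorem exists_pathSum_eq {V : Type*} (c : V → V → F) (hc : ∀ a b, c a b = c b a) (w : Fin 5 → V)
    (hδ : c (w 0) (w 3) + c (w 1) (w 3) ≠ 0)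
    (hτ : (c (w 0) (w 1) + c (w 1) (w 2) + c (w 0) (w 2)) +
      (c (w 2) (w 3) + c (w 3) (w 4) + c (w 2) (w 4)) ≠ 0)
    (hτδ : (c (w 0) (w 1) + c (w 1) (w 2) + c (w 0) (w 2)) +
      (c (w 2) (w 3) + c (w 3) (w 4) + c (w 2) (w 4)) ≠ c (w 0) (w 3) + c (w 1) (w 3)) (s : F) :
    ∃ l : List V, l.Perm [w 0, w 1, w 2, w 3] ∧ pathSum c (l ++ [w 4]) = s := by
  have key := F.eq_of_independent (c (w 0) (w 1) + c (w 1) (w 3) + c (w 3) (w 2) + c (w 2) (w 4))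
    _ _ s hδ hτ hτδ
  have h10 := hc (w 1) (w 0)
  have h20 := hc (w 2) (w 0)
  have h21 := hc (w 2) (w 1)
  have h32 := hc (w 3) (w 2)
  have hperm : ∀ m : List (Fin 5), m.Perm [0, 1, 2, 3] → (m.map w).Perm [w 0, w 1, w 2, w 3] :=
    fun m hm => hm.map w
  rcases key with rfl | rfl | rfl | rfl
  · refine ⟨_, hperm [0, 1, 3, 2] (by decide), ?_⟩
    simp only [List.map_cons, List.map_nil, List.cons_append, List.nil_append, pathSum]
    abel
  · refine ⟨_, hperm [1, 0, 3, 2] (by decide), ?_⟩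
    simp only [List.map_cons, List.map_nil, List.cons_append, List.nil_append, pathSum, h10]
    linear_combination -F.add_self (c (w 1) (w 3))
  · refine ⟨_, hperm [0, 2, 1, 3] (by decide), ?_⟩
    simp only [List.map_cons, List.map_nil, List.cons_append, List.nil_append, pathSum, h21, h32]
    linear_combination -F.add_self (c (w 0) (w 1) + c (w 2) (w 3) + c (w 2) (w 4))
  · refine ⟨_, hperm [1, 2, 0, 3] (by decide), ?_⟩
    simp only [List.map_cons, List.map_nil, List.cons_append, List.nil_append, pathSum, h20, h32]
    linear_combination
      -F.add_self (c (w 0) (w 1) + c (w 2) (w 3) + c (w 2) (w 4) + c (w 1) (w 3))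

/-- The three values are pairwise distinct. -/
def Rainbow {A : Type*} (a b c : A) : Prop := a ≠ b ∧ a ≠ c ∧ b ≠ c

instance {A : Type*} [DecidableEq A] (a b c : A) : Decidable (Rainbow a b c) :=
  inferInstanceAs (Decidable (_ ∧ _))

/-- The colour that occurs an odd number of times in a triangle that is not rainbow. -/
def oddColour {A : Type*} [DecidableEq A] (a b c : A) : A :=
  if a = b then c else if a = c then b else a

/-- The colour version of the hypotheses of `exists_pathSum_eq`. -/
def IsFlexible {V A : Type*} [DecidableEq A] (t : V → V → A) (w : Fin 5 → V) : Prop :=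
  t (w 0) (w 3) ≠ t (w 1) (w 3) ∧
  oddColour (t (w 0) (w 1)) (t (w 1) (w 2)) (t (w 0) (w 2)) ≠
    oddColour (t (w 2) (w 3)) (t (w 3) (w 4)) (t (w 2) (w 4)) ∧
  ¬ (oddColour (t (w 0) (w 1)) (t (w 1) (w 2)) (t (w 0) (w 2)) = t (w 0) (w 3) ∧
    oddColour (t (w 2) (w 3)) (t (w 3) (w 4)) (t (w 2) (w 4)) = t (w 1) (w 3)) ∧
  ¬ (oddColour (t (w 0) (w 1)) (t (w 1) (w 2)) (t (w 0) (w 2)) = t (w 1) (w 3) ∧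
    oddColour (t (w 2) (w 3)) (t (w 3) (w 4)) (t (w 2) (w 4)) = t (w 0) (w 3))

instance {V A : Type*} [DecidableEq A] (t : V → V → A) (w : Fin 5 → V) :
    Decidable (IsFlexible t w) :=
  inferInstanceAs (Decidable (_ ∧ _))

/-- A symmetric colouring of the edges of `K₅` by `Fin 3`, given by its entries. -/
def colourTable (a b c d e f g h i j : Fin 3) : Fin 5 → Fin 5 → Fin 3 :=
  ![![0, a, b, d, g], ![a, 0, c, e, h], ![b, c, 0, f, i], ![d, e, f, 0, j], ![g, h, i, j, 0]]

/-- Orderings of the vertices of `K₅`, one of which is flexible for each Gallai colouring using three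
colours. -/
def flexibleOrderings : List (Fin 5 → Fin 5) :=
  [![0, 1, 2, 3, 4], ![2, 3, 0, 1, 4], ![0, 4, 1, 2, 3], ![2, 4, 3, 0, 1], ![1, 3, 0, 4, 2],
   ![0, 3, 4, 2, 1], ![1, 2, 4, 3, 0], ![0, 4, 2, 1, 3], ![1, 3, 2, 4, 0], ![2, 4, 0, 1, 3],
   ![0, 1, 3, 2, 4], ![0, 3, 2, 1, 4], ![2, 4, 1, 0, 3]]

set_option synthInstance.maxHeartbeats 400000 in
set_option synthInstance.maxSize 10000 in
theorem exists_isFlexible_colourTable : ∀ a b c : Fin 3, ¬ Rainbow a c b →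
    ∀ d e : Fin 3, ¬ Rainbow a e d → ∀ f : Fin 3, ¬ Rainbow b f d → ¬ Rainbow c f e →
    ∀ g h : Fin 3, ¬ Rainbow a h g → ∀ i : Fin 3, ¬ Rainbow b i g → ¬ Rainbow c i h →
    ∀ j : Fin 3, ¬ Rainbow d j g → ¬ Rainbow e j h → ¬ Rainbow f j i →
    (∀ k, k ∈ [a, b, c, d, e, f, g, h, i, j]) →
    ∃ w ∈ flexibleOrderings, IsFlexible (colourTable a b c d e f g h i j) w := by
  decide +kernel

theorem exists_isFlexible (t : Fin 5 → Fin 5 → Fin 3) (h₀ : ∀ a, t a a = 0)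
    (hsymm : ∀ a b, t a b = t b a)
    (hrb : ∀ a b c, a ≠ b → a ≠ c → b ≠ c → ¬ Rainbow (t a b) (t b c) (t a c))
    (hsurj : ∀ k, ∃ a b, a ≠ b ∧ t a b = k) :
    ∃ w : Fin 5 → Fin 5, w.Injective ∧ IsFlexible t w := by
  have ht : t = colourTable (t 0 1) (t 0 2) (t 1 2) (t 0 3) (t 1 3) (t 2 3) (t 0 4) (t 1 4)
      (t 2 4) (t 3 4) := by
    funext a b
    fin_cases a <;> fin_cases b <;> first | exact h₀ _ | rfl | exact hsymm _ _
  obtain ⟨w, hw, hflex⟩ := exists_isFlexible_colourTable (t 0 1) (t 0 2) (t 1 2)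
    (by apply hrb <;> decide) (t 0 3) (t 1 3) (by apply hrb <;> decide) (t 2 3)
    (by apply hrb <;> decide) (by apply hrb <;> decide) (t 0 4) (t 1 4) (by apply hrb <;> decide)
    (t 2 4) (by apply hrb <;> decide) (by apply hrb <;> decide) (t 3 4)
    (by apply hrb <;> decide) (by apply hrb <;> decide) (by apply hrb <;> decide) (by
      intro k
      obtain ⟨a, b, hab, rfl⟩ : ∃ a b, a < b ∧ t a b = k := by
        obtain ⟨a, b, hab, hk⟩ := hsurj k
        rcases lt_or_gt_of_ne hab with h | h
        · exact ⟨a, b, h, hk⟩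
        · exact ⟨b, a, h, hsymm b a ▸ hk⟩
      fin_cases a <;> fin_cases b <;> first | exact absurd hab (by decide) | simp)
  rw [← ht] at hflex
  refine ⟨w, ?_, hflex⟩
  have hinj : ∀ w ∈ flexibleOrderings, w.Injective := by decide +kernel
  exact hinj w hw

/-- A colouring of a complete graph on at least five vertices by three colours uses all three on some
five vertices. -/
theorem exists_card_eq_five {V : Type*} [DecidableEq V] (S : Finset V) (hS : 5 ≤ S.card)
    (t : V → V → Fin 3) (hsymm : ∀ a b, t a b = t b a)
    (hsurj : ∀ k, ∃ a ∈ S, ∃ b ∈ S, a ≠ b ∧ t a b = k) :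
    ∃ T ⊆ S, T.card = 5 ∧ ∀ k, ∃ a ∈ T, ∃ b ∈ T, a ≠ b ∧ t a b = k := by
  obtain ⟨p, hp, q, hq, r, hr, hpq, hpr, hne⟩ : ∃ p ∈ S, ∃ q ∈ S, ∃ r ∈ S,
      p ≠ q ∧ p ≠ r ∧ t p q ≠ t p r := by
    obtain ⟨a, ha, b, hb, hab, h0⟩ := hsurj 0
    obtain ⟨c, hc, d, hd, hcd, h1⟩ := hsurj 1
    by_cases hbc : b = c
    · subst hbc
      exact ⟨b, hb, a, ha, d, hd, hab.symm, hcd, by rw [hsymm b a, h0, h1]; decide⟩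
    by_cases h : t b c = 0
    · exact ⟨c, hc, b, hb, d, hd, Ne.symm hbc, hcd, by rw [hsymm c b, h, h1]; decide⟩
    · exact ⟨b, hb, a, ha, c, hc, hab.symm, hbc, by rw [hsymm b a, h0]; exact Ne.symm h⟩
  obtain ⟨k, hk⟩ : ∃ k, ∀ j, j = t p q ∨ j = t p r ∨ j = k := by
    generalize t p q = a, t p r = b at hne
    decide +revert
  obtain ⟨a, ha, b, hb, hab, hk'⟩ := hsurj k
  have hsub : {p, q, r, a, b} ⊆ S := by
    simp [Finset.insert_subset_iff, *]
  obtain ⟨T, hT, hTS, hcard⟩ := Finset.exists_subsuperset_card_eq hsub Finset.card_le_five hS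
  simp only [Finset.insert_subset_iff, Finset.singleton_subset_iff] at hT
  refine ⟨T, hTS, hcard, fun j => ?_⟩
  rcases hk j with rfl | rfl | rfl
  · exact ⟨p, hT.1, q, hT.2.1, hpq, rfl⟩
  · exact ⟨p, hT.1, r, hT.2.2.1, hpr, rfl⟩
  · exact ⟨a, hT.2.2.2.1, b, hT.2.2.2.2, hab, hk'⟩

theorem not_rainbow_of_add_eq (f : Fin 3 → F) (hf : f.Injective) (i j k m : Fin 3)
    (h : f i + f j + f k = f m) : ¬ Rainbow i j k := by
  decide +kernel +revert

theorem apply_oddColour {A : Type*} [DecidableEq A] (f : A → F) {i j k : A} (h : ¬ Rainbow i j k) :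
    f (oddColour i j k) = f i + f j + f k := by
  unfold oddColour
  split_ifs with hij hik
  · rw [hij, F.add_self, zero_add]
  · rw [hik, add_right_comm, F.add_self, zero_add]
  · obtain rfl : j = k := by
      by_contra hjk
      exact h ⟨hij, hik, hjk⟩
    rw [add_assoc, F.add_self, add_zero]

theorem eq_or_eq_or_eq_of_add_eq (f : Fin 3 → F) (hf : f.Injective) (i j k m : Fin 3)
    (h : f i + f j + f k = f m) : i = m ∨ j = m ∨ k = m := by
  rw [← apply_oddColour f (not_rainbow_of_add_eq f hf i j k m h)] at h
  have := hf h
  unfold oddColour at this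
  split_ifs at this <;> tauto

theorem add_ne_add_of_pair_ne (f : Fin 3 → F) (hf : f.Injective) (p q r s : Fin 3) (hpq : p ≠ q)
    (hrs : r ≠ s) (h₁ : ¬ (r = p ∧ s = q)) (h₂ : ¬ (r = q ∧ s = p)) : f r + f s ≠ f p + f q := by
  decide +kernel +revert

theorem F.add_ne_zero {a b : F} (h : a ≠ b) : a + b ≠ 0 := by
  decide +revert

theorem IsFlexible.exists_pathSum_eq {V : Type*} {t : V → V → Fin 3} {w : Fin 5 → V}
    (h : IsFlexible t w) (c : V → V → F) (hc : ∀ a b, c a b = c b a) (f : Fin 3 → F)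
    (hf : f.Injective) (hcf : ∀ i j, i ≠ j → c (w i) (w j) = f (t (w i) (w j)))
    (hrb : ∀ i j k, i ≠ j → i ≠ k → j ≠ k →
      ¬ Rainbow (t (w i) (w j)) (t (w j) (w k)) (t (w i) (w k))) (s : F) :
    ∃ l : List V, l.Perm [w 0, w 1, w 2, w 3] ∧ pathSum c (l ++ [w 4]) = s := by
  obtain ⟨h₁, h₂, h₃, h₄⟩ := h
  have hodd : ∀ i j k, i ≠ j → i ≠ k → j ≠ k → c (w i) (w j) + c (w j) (w k) + c (w i) (w k) =
      f (oddColour (t (w i) (w j)) (t (w j) (w k)) (t (w i) (w k))) := fun i j k hij hik hjk => by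
    rw [apply_oddColour f (hrb i j k hij hik hjk), hcf i j hij, hcf j k hjk, hcf i k hik]
  apply _root_.exists_pathSum_eq c hc w
  · rw [hcf 0 3 (by decide), hcf 1 3 (by decide)]
    exact F.add_ne_zero (hf.ne h₁)
  · rw [hodd 0 1 2 (by decide) (by decide) (by decide),
      hodd 2 3 4 (by decide) (by decide) (by decide)]
    exact F.add_ne_zero (hf.ne h₂)
  · rw [hodd 0 1 2 (by decide) (by decide) (by decide),
      hodd 2 3 4 (by decide) (by decide) (by decide), hcf 0 3 (by decide), hcf 1 3 (by decide)]
    exact add_ne_add_of_pair_ne f hf _ _ _ _ h₁ h₂ h₃ h₄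

theorem triSign_swap_left {n : ℕ} (σ : Sym2 (Fin n) → F) (a b c : Fin n) :
    triSign σ a b c = triSign σ b a c := by
  simp only [triSign, Sym2.eq_swap (a := a) (b := b)]
  abel

theorem triSign_swap_right {n : ℕ} (σ : Sym2 (Fin n) → F) (a b c : Fin n) :
    triSign σ a b c = triSign σ a c b := by
  simp only [triSign, Sym2.eq_swap (a := b) (b := c)]
  abel

theorem stmt5 (n : ℕ) (hn : 6 ≤ n) (σ : Sym2 (Fin n) → F)
    (h : ∃ x y z : F, x ≠ y ∧ x ≠ z ∧ y ≠ z ∧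
      {g : F | ∃ a b c : Fin n,
        a ≠ b ∧ a ≠ c ∧ b ≠ c ∧ triSign σ a b c = g} = {x, y, z}) :
    ∀ g : F, ∃ (v : Fin n) (w : (⊤ : SimpleGraph (Fin n)).Walk v v),
      w.IsHamiltonianCycle ∧ walkSign σ w = g := by
  intro g
  obtain ⟨f, hf, hset⟩ : ∃ f : Fin 3 → F, f.Injective ∧ {g : F | ∃ a b c : Fin n,
      a ≠ b ∧ a ≠ c ∧ b ≠ c ∧ triSign σ a b c = g} = Set.range f := by
    obtain ⟨x, y, z, hxy, hxz, hyz, hset⟩ := h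
    refine ⟨![x, y, z], ?_, ?_⟩
    · intro i j hij
      fin_cases i <;> fin_cases j <;> simp_all
    · rw [hset]
      ext
      simp [or_left_comm, or_comm, eq_comm]
  have hmem : ∀ a b c, a ≠ b → a ≠ c → b ≠ c → ∃ k, f k = triSign σ a b c := fun a b c hab hac hbc =>
    hset.subset ⟨a, b, c, hab, hac, hbc, rfl⟩
  let v : Fin n := ⟨0, by omega⟩
  let t : Fin n → Fin n → Fin 3 := fun a b =>
    if a = b then 0 else Function.invFun f (triSign σ v a b)
  have ht₀ : ∀ a, t a a = 0 := fun a => if_pos rfl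
  have htsymm : ∀ a b, t a b = t b a := fun a b => by
    simp only [t, eq_comm (a := a), triSign_swap_right σ v a b]
  have htf : ∀ a b, a ≠ v → b ≠ v → a ≠ b → f (t a b) = triSign σ v a b := fun a b ha hb hab => by
    simp only [t, if_neg hab]
    exact Function.invFun_eq (hmem v a b ha.symm hb.symm hab)
  have hadd : ∀ a b c, a ≠ v → b ≠ v → c ≠ v → a ≠ b → a ≠ c → b ≠ c →
      f (t a b) + f (t b c) + f (t a c) = triSign σ a b c := fun a b c ha hb hc hab hac hbc => by
    rw [htf a b ha hb hab, htf b c hb hc hbc, htf a c ha hc hac, ← triSign_eq_add]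
  have hrb : ∀ a b c, a ≠ v → b ≠ v → c ≠ v → a ≠ b → a ≠ c → b ≠ c →
      ¬ Rainbow (t a b) (t b c) (t a c) := fun a b c ha hb hc hab hac hbc => by
    obtain ⟨k, hk⟩ := hmem a b c hab hac hbc
    exact not_rainbow_of_add_eq f hf _ _ _ k (by rw [hadd a b c ha hb hc hab hac hbc, hk])
  have hsurj : ∀ k, ∃ a ∈ Finset.univ.erase v, ∃ b ∈ Finset.univ.erase v, a ≠ b ∧ t a b = k := by
    intro k
    simp only [Finset.mem_erase, Finset.mem_univ, and_true]
    obtain ⟨a, b, c, hab, hac, hbc, hk⟩ := hset.superset ⟨k, rfl⟩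
    by_cases ha : a = v
    · rw [ha] at hab hac hk
      exact ⟨b, hab.symm, c, hac.symm, hbc, hf (by rw [htf b c hab.symm hac.symm hbc, hk])⟩
    by_cases hb : b = v
    · rw [triSign_swap_left, hb] at hk
      rw [hb] at hbc
      exact ⟨a, ha, c, hbc.symm, hac, hf (by rw [htf a c ha hbc.symm hac, hk])⟩
    by_cases hc : c = v
    · rw [triSign_swap_right, triSign_swap_left, hc] at hk
      exact ⟨a, ha, b, hb, hab, hf (by rw [htf a b ha hb hab, hk])⟩
    rcases eq_or_eq_or_eq_of_add_eq f hf _ _ _ k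
      ((hadd a b c ha hb hc hab hac hbc).trans hk) with h | h | h
    · exact ⟨a, ha, b, hb, hab, h⟩
    · exact ⟨b, hb, c, hc, hbc, h⟩
    · exact ⟨a, ha, c, hc, hac, h⟩
  obtain ⟨T, hTS, hcard, hT⟩ := exists_card_eq_five (Finset.univ.erase v) (by simp; omega) t htsymm
    hsurj
  have hTv : ∀ a ∈ T, a ≠ v := fun a ha => Finset.ne_of_mem_erase (hTS ha)
  let u : Fin 5 ≃ T := (T.equivFinOfCardEq hcard).symm
  have huv : ∀ i, (u i : Fin n) ≠ v := fun i => hTv _ (u i).2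
  have hu : ∀ i j, i ≠ j → (u i : Fin n) ≠ u j := fun i j hij =>
    Subtype.coe_injective.ne (u.injective.ne hij)
  obtain ⟨q, hq, hflex⟩ := exists_isFlexible (fun i j => t (u i) (u j)) (fun i => ht₀ _)
    (fun i j => htsymm _ _)
    (fun i j k hij hik hjk => hrb _ _ _ (huv i) (huv j) (huv k) (hu i j hij) (hu i k hik)
      (hu j k hjk))
    (fun k => by
      obtain ⟨a, ha, b, hb, hab, hk⟩ := hT k
      refine ⟨u.symm ⟨a, ha⟩, u.symm ⟨b, hb⟩, ?_, by simpa using hk⟩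
      simpa using hab)
  let w : Fin 5 → Fin n := fun i => u (q i)
  have hw : ∀ i j, i ≠ j → w i ≠ w j := fun i j hij => hu _ _ (hq.ne hij)
  have hflex' : IsFlexible t w := hflex
  obtain ⟨l, hl, hsum⟩ := hflex'.exists_pathSum_eq (triSign σ v) (triSign_swap_right σ v) f hf
    (fun i j hij => (htf _ _ (huv _) (huv _) (hw i j hij)).symm)
    (fun i j k hij hik hjk => hrb _ _ _ (huv _) (huv _) (huv _) (hw i j hij) (hw i k hik)
      (hw j k hjk))
    (g + pathSum (triSign σ v) (w 4 :: ((Finset.univ.erase v) \ T).toList))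
  set r := ((Finset.univ.erase v) \ T).toList with hr
  have hperm : (v :: (l ++ w 4 :: r)).Perm (v :: (List.ofFn w ++ r)) := by
    refine List.Perm.cons _ ?_
    have : List.ofFn w ++ r = [w 0, w 1, w 2, w 3] ++ w 4 :: r := by simp [List.ofFn_succ]
    rw [this]
    exact hl.append_right _
  obtain ⟨c, hc, hcs⟩ := exists_isHamiltonianCycle_of_nodup σ v (l ++ w 4 :: r) (by
      rw [hperm.nodup_iff, List.nodup_cons, List.nodup_append]
      refine ⟨?_, List.nodup_ofFn.2 fun i j hij => ?_, Finset.nodup_toList _, ?_⟩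
      · simp only [List.mem_append, List.mem_ofFn, hr, Finset.mem_toList, Finset.mem_sdiff,
          Finset.mem_erase]
        rintro (⟨i, hi⟩ | h)
        · exact huv _ hi
        · exact h.1.1 rfl
      · by_contra hne
        exact hw i j hne hij
      · intro a ha b hb
        simp only [List.mem_ofFn, hr, Finset.mem_toList, Finset.mem_sdiff] at ha hb
        obtain ⟨i, rfl⟩ := ha
        rintro rfl
        exact hb.2 (u (q i)).2) (by simp [hl.length_eq]; omega) (by
      intro x
      rw [hperm.mem_iff]
      simp only [List.mem_cons, List.mem_append, List.mem_ofFn, hr, Finset.mem_toList,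
        Finset.mem_sdiff, Finset.mem_erase, Finset.mem_univ, and_true]
      by_cases hx : x ∈ T
      · obtain ⟨i, hi⟩ := Finite.surjective_of_injective hq (u.symm ⟨x, hx⟩)
        exact Or.inr (Or.inl ⟨i, by simp [w, hi]⟩)
      · tauto)
  refine ⟨v, c, hc, ?_⟩
  rw [hcs, pathSum_append, hsum, add_assoc, F.add_self, add_zero]
end

section
/- Let σ be an edge labeling of K_4 by F such that the four triangles of K_4 have pairwise distinct double signs. Then there exists a vertex v of K_4 such that among the Hamiltonian paths of K_4 having v as an endpoint there are four with pairwise distinct double signs (i.e., all four elements of F occur as double signs of Hamiltonian paths starting at v), if and only if there is no g ∈ F for which exactly three edges of K_4 have label g with these three edges sharing a common vertex or forming a triangle. -/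
/-- The four triangles of `K₄` have pairwise distinct double signs (a `Σ₄*`). -/
def DistinctTriSigns (σ : Sym2 (Fin 4) → F) : Prop :=
  triSign σ 0 1 2 ≠ triSign σ 0 1 3 ∧ triSign σ 0 1 2 ≠ triSign σ 0 2 3 ∧
  triSign σ 0 1 2 ≠ triSign σ 1 2 3 ∧ triSign σ 0 1 3 ≠ triSign σ 0 2 3 ∧
  triSign σ 0 1 3 ≠ triSign σ 1 2 3 ∧ triSign σ 0 2 3 ≠ triSign σ 1 2 3

/-- The double sign of the Hamiltonian path `π 0 — π 1 — π 2 — π 3` of `K₄`;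
every Hamiltonian path of `K₄` arises this way from a permutation of the vertices. -/
def permPathSign (σ : Sym2 (Fin 4) → F) (π : Equiv.Perm (Fin 4)) : F :=
  σ s(π 0, π 1) + σ s(π 1, π 2) + σ s(π 2, π 3)

/-- Exactly three edges of `K₄` carry the label `g`, and these three edges
either share a common vertex or form a triangle. -/
def ThreeEdgesSpecial (σ : Sym2 (Fin 4) → F) (g : F) : Prop :=
  Set.ncard {e : Sym2 (Fin 4) | ¬ e.IsDiag ∧ σ e = g} = 3 ∧
  ((∃ v : Fin 4, ∀ e : Sym2 (Fin 4), ¬ e.IsDiag → σ e = g → v ∈ e) ∨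
   (∃ a b c : Fin 4, a ≠ b ∧ a ≠ c ∧ b ≠ c ∧
      {e : Sym2 (Fin 4) | ¬ e.IsDiag ∧ σ e = g} = {s(a, b), s(b, c), s(a, c)}))

set_option synthInstance.maxSize 4000 in
/-- The equivalence with paths, triangles and stars of `K₄` written out; `a`, `b`, `c`, `d`, `e`,
`f` are the labels of the edges `01`, `02`, `03`, `12`, `13`, `23`. -/
theorem forall_path_sign_iff_labels : ∀ a b c d e f : F,
    (a + d + b ≠ a + e + c ∧ a + d + b ≠ b + f + c ∧ a + d + b ≠ d + f + e ∧
      a + e + c ≠ b + f + c ∧ a + e + c ≠ d + f + e ∧ b + f + c ≠ d + f + e) →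
    (((∀ g : F, a + d + f = g ∨ a + e + f = g ∨ b + d + e = g ∨ b + f + e = g ∨
          c + e + d = g ∨ c + f + d = g) ∨
      (∀ g : F, a + b + f = g ∨ a + c + f = g ∨ d + b + c = g ∨ d + f + c = g ∨
          e + c + b = g ∨ e + f + b = g) ∨
      (∀ g : F, b + a + e = g ∨ b + c + e = g ∨ d + a + c = g ∨ d + e + c = g ∨
          f + c + a = g ∨ f + e + a = g) ∨
      (∀ g : F, c + a + d = g ∨ c + b + d = g ∨ e + a + b = g ∨ e + d + b = g ∨
          f + b + a = g ∨ f + d + a = g)) ↔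
    ¬ ∃ g : F,
      (a = g ∧ b = g ∧ c = g ∧ d ≠ g ∧ e ≠ g ∧ f ≠ g) ∨
      (a ≠ g ∧ b ≠ g ∧ c ≠ g ∧ d = g ∧ e = g ∧ f = g) ∨
      (a = g ∧ b ≠ g ∧ c ≠ g ∧ d = g ∧ e = g ∧ f ≠ g) ∨
      (a ≠ g ∧ b = g ∧ c = g ∧ d ≠ g ∧ e ≠ g ∧ f = g) ∨
      (a ≠ g ∧ b = g ∧ c ≠ g ∧ d = g ∧ e ≠ g ∧ f = g) ∨
      (a = g ∧ b ≠ g ∧ c = g ∧ d ≠ g ∧ e = g ∧ f ≠ g) ∨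
      (a ≠ g ∧ b ≠ g ∧ c = g ∧ d ≠ g ∧ e = g ∧ f = g) ∨
      (a = g ∧ b = g ∧ c ≠ g ∧ d = g ∧ e ≠ g ∧ f ≠ g)) := by
  decide +kernel

theorem forall_edge_iff {p : Sym2 (Fin 4) → Prop} :
    (∀ x : Sym2 (Fin 4), ¬ x.IsDiag → p x) ↔
      p s(0, 1) ∧ p s(0, 2) ∧ p s(0, 3) ∧ p s(1, 2) ∧ p s(1, 3) ∧ p s(2, 3) := by
  constructor
  · intro h
    refine ⟨?_, ?_, ?_, ?_, ?_, ?_⟩ <;> exact h _ (by decide)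
  · rintro ⟨h₁, h₂, h₃, h₄, h₅, h₆⟩ x hx
    have key : ∀ x : Sym2 (Fin 4), ¬ x.IsDiag → x = s(0, 1) ∨ x = s(0, 2) ∨ x = s(0, 3) ∨
        x = s(1, 2) ∨ x = s(1, 3) ∨ x = s(2, 3) := by decide
    rcases key x hx with rfl | rfl | rfl | rfl | rfl | rfl <;> assumption

theorem card_edges_mem (v : Fin 4) :
    ({x : Sym2 (Fin 4) | ¬ x.IsDiag ∧ v ∈ x} : Finset (Sym2 (Fin 4))).card = 3 := by
  revert v; decide

theorem card_edges_notMem (v : Fin 4) :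
    ({x : Sym2 (Fin 4) | ¬ x.IsDiag ∧ v ∉ x} : Finset (Sym2 (Fin 4))).card = 3 := by
  revert v; decide

/-- Every triangle of `K₄` consists of the edges avoiding the fourth vertex. -/
theorem exists_triangle_eq_edges_notMem {a b c : Fin 4} (hab : a ≠ b) (hac : a ≠ c) (hbc : b ≠ c) :
    ∃ v : Fin 4, ∀ x : Sym2 (Fin 4),
      x = s(a, b) ∨ x = s(b, c) ∨ x = s(a, c) ↔ ¬ x.IsDiag ∧ v ∉ x := by
  revert a b c; decide +kernel

theorem exists_edges_notMem_eq_triangle (v : Fin 4) :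
    ∃ a b c : Fin 4, a ≠ b ∧ a ≠ c ∧ b ≠ c ∧ ∀ x : Sym2 (Fin 4),
      ¬ x.IsDiag ∧ v ∉ x ↔ x = s(a, b) ∨ x = s(b, c) ∨ x = s(a, c) := by
  revert v; decide +kernel

theorem threeEdgesSpecial_iff (σ : Sym2 (Fin 4) → F) (g : F) :
    ThreeEdgesSpecial σ g ↔ ∃ v : Fin 4,
      (∀ x : Sym2 (Fin 4), ¬ x.IsDiag → (σ x = g ↔ v ∈ x)) ∨
      (∀ x : Sym2 (Fin 4), ¬ x.IsDiag → (σ x = g ↔ v ∉ x)) := by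
  have hS : {x : Sym2 (Fin 4) | ¬ x.IsDiag ∧ σ x = g} =
      (({x | ¬ x.IsDiag ∧ σ x = g} : Finset (Sym2 (Fin 4))) : Set (Sym2 (Fin 4))) := by
    ext; simp
  have hcard : Set.ncard {x : Sym2 (Fin 4) | ¬ x.IsDiag ∧ σ x = g} =
      ({x | ¬ x.IsDiag ∧ σ x = g} : Finset (Sym2 (Fin 4))).card := by
    rw [hS, Set.ncard_coe_finset]
  constructor
  · rintro ⟨h3, ⟨v, hv⟩ | ⟨a, b, c, hab, hac, hbc, h⟩⟩
    · refine ⟨v, Or.inl ?_⟩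
      have heq := Finset.eq_of_subset_of_card_le
        (s := ({x | ¬ x.IsDiag ∧ σ x = g} : Finset (Sym2 (Fin 4))))
        (t := ({x | ¬ x.IsDiag ∧ v ∈ x} : Finset (Sym2 (Fin 4))))
        (fun x => by simpa using fun hx hg => ⟨hx, hv x hx hg⟩)
        (by rw [card_edges_mem, ← hcard, h3])
      intro x hx
      have := Finset.ext_iff.mp heq x
      simpa [hx] using this
    · obtain ⟨v, hv⟩ := exists_triangle_eq_edges_notMem hab hac hbc
      refine ⟨v, Or.inr fun x hx => ?_⟩
      have h₁ := Set.ext_iff.mp h x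
      have h₂ := hv x
      simp only [Set.mem_ofPred_eq, Set.mem_insert_iff, Set.mem_singleton_iff] at h₁
      tauto
  · rintro ⟨v, hv | hv⟩
    · refine ⟨?_, Or.inl ⟨v, fun x hx hg => (hv x hx).mp hg⟩⟩
      rw [hcard, ← card_edges_mem v]
      congr 1
      ext x
      simpa using hv x
    · obtain ⟨a, b, c, hab, hac, hbc, h⟩ := exists_edges_notMem_eq_triangle v
      refine ⟨?_, Or.inr ⟨a, b, c, hab, hac, hbc, ?_⟩⟩
      · rw [hcard, ← card_edges_notMem v]
        congr 1
        ext x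
        simpa using hv x
      · ext x
        simp only [Set.mem_ofPred_eq, Set.mem_insert_iff, Set.mem_singleton_iff, ← h x]
        exact and_congr_right (hv x)

/-- A permutation of the four vertices is the list of its values. -/
theorem exists_perm_iff (p : Fin 4 → Fin 4 → Fin 4 → Fin 4 → Prop) :
    (∃ π : Equiv.Perm (Fin 4), p (π 0) (π 1) (π 2) (π 3)) ↔
      ∃ i j k l : Fin 4, [i, j, k, l].Nodup ∧ p i j k l := by
  constructor
  · rintro ⟨π, h⟩
    exact ⟨π 0, π 1, π 2, π 3, by simp, h⟩
  · rintro ⟨i, j, k, l, hn, h⟩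
    have hinj : Function.Injective ![i, j, k, l] := by
      rw [← List.nodup_ofFn]
      simpa using hn
    exact ⟨Equiv.ofBijective _ (Finite.injective_iff_bijective.mp hinj), h⟩

theorem stmt14 (σ : Sym2 (Fin 4) → F) (h : DistinctTriSigns σ) :
    (∃ v : Fin 4, ∀ g : F, ∃ π : Equiv.Perm (Fin 4),
      π 0 = v ∧ permPathSign σ π = g) ↔
    ¬ ∃ g : F, ThreeEdgesSpecial σ g := by
  have key := forall_path_sign_iff_labels (σ s(0, 1)) (σ s(0, 2)) (σ s(0, 3)) (σ s(1, 2))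
    (σ s(1, 3)) (σ s(2, 3)) h
  have hpath (v : Fin 4) (g : F) :
      (∃ π : Equiv.Perm (Fin 4), π 0 = v ∧ permPathSign σ π = g) ↔
        ∃ i j k l : Fin 4, [i, j, k, l].Nodup ∧
          i = v ∧ σ s(i, j) + σ s(j, k) + σ s(k, l) = g :=
    exists_perm_iff fun i j k l => i = v ∧ σ s(i, j) + σ s(j, k) + σ s(k, l) = g
  have h10 : s((1 : Fin 4), 0) = s(0, 1) := Sym2.eq_swap
  have h20 : s((2 : Fin 4), 0) = s(0, 2) := Sym2.eq_swap
  have h30 : s((3 : Fin 4), 0) = s(0, 3) := Sym2.eq_swap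
  have h21 : s((2 : Fin 4), 1) = s(1, 2) := Sym2.eq_swap
  have h31 : s((3 : Fin 4), 1) = s(1, 3) := Sym2.eq_swap
  have h32 : s((3 : Fin 4), 2) = s(2, 3) := Sym2.eq_swap
  simp only [hpath, threeEdgesSpecial_iff, forall_edge_iff]
  convert key using 1
  · simp [Fin.exists_fin_succ, h10, h20, h30, h21, h31, h32, or_assoc]
  · simp [Fin.exists_fin_succ, or_assoc]
end
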